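/- If m ∈ WalkCover(p,t) for an event (p,t), then there exists an elementary walk m' ∈ WalkCover(p,t) such that m →* m'. -/

import Mathlib

/-- `(p,0)` is an event for every `p`, and `(p,t+1)` is an event iff `p ∈ A t`. -/
def IsEvent {V : Type*} (A : ℕ → Set V) (p : V) (t : ℕ) : Prop :=
  t = 0 ∨ ∃ t', t = t' + 1 ∧ p ∈ A t'

/-- The causal relation `⇝` on events. -/
def Leadsto {V : Type*} (G : SimpleGraph V) (A : ℕ → Set V) (e f : V × ℕ) : Prop :=
  (e.1 = f.1 ∨ G.Adj e.1 f.1) ∧ IsEvent A f.1 f.2 ∧ 0 < f.2 ∧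
    IsEvent A e.1 e.2 ∧ e.2 < f.2 ∧ ∀ s, e.2 < s → s < f.2 → ¬ IsEvent A e.1 s

/-- `WalkCover(p,t)`: walks `q₀q₁…q_r` associated to causal chains
`(q₀,t₀) ⇝ … ⇝ (q_r,t_r) = (p,t)`, together with the length-0 walk `p`. -/
def WalkCover {V : Type*} (G : SimpleGraph V) (A : ℕ → Set V) (p : V) (t : ℕ) :
    Set (List V) :=
  {m | m = [p] ∨ ∃ C : List (V × ℕ), C ≠ [] ∧ List.Chain' (Leadsto G A) C ∧
    C.getLast? = some (p, t) ∧ m = C.map Prod.fst}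

/-- A circular walk. -/
def IsCircular {V : Type*} (G : SimpleGraph V) (u : List V) : Prop :=
  (u ≠ [] ∧ u.Chain' (fun a b => a = b ∨ G.Adj a b)) ∧ 2 ≤ u.length ∧
    u.head? = u.getLast?

/-- One step of the rewriting relation on walks. -/
def StepRw {V : Type*} (G : SimpleGraph V) (m m' : List V) : Prop :=
  ∃ (m₁ u m₂ : List V) (h : V), IsCircular G u ∧ u.head? = some h ∧
    m = m₁ ++ u ++ m₂ ∧ m' = m₁ ++ [h] ++ m₂

/-- `m →* m'`. -/
def RwStar {V : Type*} (G : SimpleGraph V) : List V → List V → Prop :=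
  Relation.ReflTransGen (StepRw G)

/-- An elementary walk. -/
def Elementary {V : Type*} (m : List V) : Prop :=
  ∀ i j k : ℕ, i ≤ k → k ≤ j → j < m.length → m[i]? = m[j]? → m[k]? = m[i]?

/-- Every event of `q` before `t` is dominated by a latest one. -/
theorem exists_latest_event {V : Type*} (A : ℕ → Set V) {q : V} {s t : ℕ} (hs : IsEvent A q s)
    (hst : s < t) :
    ∃ s', s ≤ s' ∧ s' < t ∧ IsEvent A q s' ∧ ∀ r, s' < r → r < t → ¬ IsEvent A q r := by
  classical
  have hspec := Nat.findGreatest_spec (P := IsEvent A q) (n := t - 1) (by omega) hs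
  have hle := Nat.findGreatest_le (P := IsEvent A q) (t - 1)
  have hge := Nat.le_findGreatest (P := IsEvent A q) (n := t - 1) (by omega) hs
  refine ⟨_, hge, by omega, hspec, fun r hr hrt ↦ ?_⟩
  exact Nat.findGreatest_is_greatest hr (by omega)

/-- A causal chain can be delayed so as to end at any later event of its last vertex. -/
theorem exists_delayed_chain {V : Type*} (G : SimpleGraph V) (A : ℕ → Set V)
    (C : List (V × ℕ)) {h : V} {t t' : ℕ} (htt' : t ≤ t') (ht' : IsEvent A h t')
    (hC : List.IsChain (Leadsto G A) (C ++ [(h, t)])) :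
    ∃ C' : List (V × ℕ), C'.map Prod.fst = C.map Prod.fst ∧
      List.IsChain (Leadsto G A) (C' ++ [(h, t')]) := by
  induction C using List.reverseRecOn generalizing h t t' with
  | nil => exact ⟨[], rfl, by simp⟩
  | append_singleton D e ih =>
    obtain ⟨q, s⟩ := e
    rw [List.append_assoc, List.singleton_append, List.isChain_split,
      List.isChain_pair] at hC
    obtain ⟨hD, hadj, -, -, hs, hst, -⟩ := hC
    dsimp only at hadj hs hst
    obtain ⟨s', hss', hs't', hs', hlatest⟩ := exists_latest_event A hs (hst.trans_le htt')
    obtain ⟨D', hmap, hD'⟩ := ih hss' hs' hD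
    refine ⟨D' ++ [(q, s')], by simp [hmap], ?_⟩
    rw [List.append_assoc, List.singleton_append, List.isChain_split, List.isChain_pair]
    exact ⟨hD', hadj, ht', by dsimp only; omega, hs', hs't', hlatest⟩

/-- Two entries with the same image split a list whose image has duplicates. -/
theorem exists_split_of_not_nodup_map {α β : Type*} (f : α → β) (l : List α)
    (hl : ¬ (l.map f).Nodup) :
    ∃ l₁ x l₂ y l₃, l = l₁ ++ x :: (l₂ ++ y :: l₃) ∧ f x = f y := by
  induction l with
  | nil => simp at hl
  | cons a l ih =>
    by_cases ha : f a ∈ l.map f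
    · obtain ⟨y, hy, hya⟩ := List.mem_map.1 ha
      obtain ⟨l₂, l₃, rfl⟩ := List.append_of_mem hy
      exact ⟨[], a, l₂, y, l₃, rfl, hya.symm⟩
    · obtain ⟨l₁, x, l₂, y, l₃, rfl, hxy⟩ :=
        ih fun hl' ↦ hl (by rw [List.map_cons]; exact List.nodup_cons.2 ⟨ha, hl'⟩)
      exact ⟨a :: l₁, x, l₂, y, l₃, rfl, hxy⟩

theorem elementary_of_nodup {V : Type*} {m : List V} (hm : m.Nodup) : Elementary m := by
  intro i j k hik hkj hj hij
  have : i = j := (List.getElem?_inj (by omega) hm).1 hij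
  obtain rfl : k = i := by omega
  rfl

/-- The vertex sequence of a causal chain rewrites to a duplicate-free one ending at the
same event. -/
theorem exists_nodup_rwStar {V : Type*} (G : SimpleGraph V) (A : ℕ → Set V) {e : V × ℕ}
    (C : List (V × ℕ)) (hC : List.IsChain (Leadsto G A) C) (hlast : C.getLast? = some e) :
    ∃ C' : List (V × ℕ), List.IsChain (Leadsto G A) C' ∧ C'.getLast? = some e ∧
      (C'.map Prod.fst).Nodup ∧ RwStar G (C.map Prod.fst) (C'.map Prod.fst) := by
  induction hn : C.length using Nat.strong_induction_on generalizing C with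
  | _ n ih =>
  by_cases hnd : (C.map Prod.fst).Nodup
  · exact ⟨C, hC, hlast, hnd, Relation.ReflTransGen.refl⟩
  obtain ⟨C₁, ⟨h, a⟩, C₂, ⟨h', b⟩, C₃, rfl, hh⟩ := exists_split_of_not_nodup_map _ C hnd
  obtain rfl : h = h' := hh
  obtain ⟨hC₁, hmid⟩ := List.isChain_split.1 hC
  rw [← List.cons_append] at hmid
  obtain ⟨hloop, hC₃⟩ := List.isChain_split.1 hmid
  have htrans : ∀ x y, Leadsto G A x y → IsEvent A y.1 y.2 ∧ x.2 < y.2 :=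
    fun x y hxy ↦ ⟨hxy.2.1, hxy.2.2.2.2.1⟩
  have hab : a ≤ b := by
    have hlt : List.IsChain (fun x y : V × ℕ ↦ x.2 < y.2) ((h, a) :: (C₂ ++ [(h, b)])) :=
      hloop.imp fun x y hxy ↦ (htrans x y hxy).2
    have : IsTrans (V × ℕ) (fun x y : V × ℕ ↦ x.2 < y.2) := ⟨fun _ _ _ ↦ lt_trans⟩
    exact ((List.pairwise_cons.1 hlt.pairwise).1 (h, b) (by simp)).le
  have hb : IsEvent A h b := by
    rcases List.eq_nil_or_concat C₂ with rfl | ⟨D, x, rfl⟩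
    · exact (htrans _ _ (List.isChain_pair.1 hloop)).1
    · have hx : List.IsChain (Leadsto G A) (((h, a) :: D) ++ x :: [(h, b)]) := by
        simpa using hloop
      exact (htrans _ _ (List.isChain_pair.1 (List.isChain_split.1 hx).2)).1
  obtain ⟨D, hmap, hD⟩ := exists_delayed_chain G A C₁ hab hb hC₁
  have hlen : D.length = C₁.length := by simpa using congrArg List.length hmap
  obtain ⟨C', hC', hlast', hnd', hrw⟩ := ih (D ++ (h, b) :: C₃).length
    (by simp at hn ⊢; omega) (D ++ (h, b) :: C₃) (List.isChain_split.2 ⟨hD, hC₃⟩)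
    (by
      rw [← hlast, ← List.cons_append, ← List.append_assoc, List.getLast?_append_cons,
        List.getLast?_append_cons]) rfl
  refine ⟨C', hC', hlast', hnd', Relation.ReflTransGen.head ?_ hrw⟩
  refine ⟨C₁.map Prod.fst, ((h, a) :: (C₂ ++ [(h, b)])).map Prod.fst, C₃.map Prod.fst, h,
    ⟨⟨by simp, ?_⟩, by simp, ?_⟩, by simp,
    by simp, by simp [hmap]⟩
  · exact (List.isChain_map _).2 (hloop.imp fun x y hxy ↦ hxy.1)
  · rw [← List.cons_append, List.map_append, List.map_singleton, List.getLast?_concat]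
    rfl

/-- If `m ∈ WalkCover(p,t)` for an event `(p,t)`, then there
exists an elementary walk `m' ∈ WalkCover(p,t)` such that `m →* m'`. -/
theorem stmt_15 {V : Type*} [Fintype V] (G : SimpleGraph V) (hconn : G.Connected)
    (ℓ : ℕ → V → ℤ) (A : ℕ → Set V)
    (hA : ∀ t, (A t).Nonempty)
    (hguard : ∀ t, ∀ p ∈ A t, ∀ q, G.Adj p q → ℓ t q = ℓ t p ∨ ℓ t q = ℓ t p + 1)
    (hfire : ∀ t, ∀ p ∈ A t, ℓ (t + 1) p = ℓ t p + 1)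
    (hstay : ∀ t, ∀ p, p ∉ A t → ℓ (t + 1) p = ℓ t p)
    (hinit : ∀ p q, G.Adj p q → |ℓ 0 p - ℓ 0 q| ≤ 1) :
    ∀ (p : V) (t : ℕ), IsEvent A p t →
      ∀ m ∈ WalkCover G A p t,
        ∃ m' ∈ WalkCover G A p t, Elementary m' ∧ RwStar G m m' := by
  intro p t _ m hm
  obtain ⟨C, hC, hlast, rfl⟩ : ∃ C : List (V × ℕ), List.IsChain (Leadsto G A) C ∧
      C.getLast? = some (p, t) ∧ m = C.map Prod.fst := by
    rcases hm with rfl | ⟨C, -, hC, hlast, rfl⟩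
    · exact ⟨[(p, t)], by simp, rfl, rfl⟩
    · exact ⟨C, hC, hlast, rfl⟩
  obtain ⟨C', hC', hlast', hnd, hrw⟩ := exists_nodup_rwStar G A C hC hlast
  have hne : C' ≠ [] := by
    rintro rfl
    simp at hlast'
  exact ⟨_, Or.inr ⟨C', hne, hC', hlast', rfl⟩, elementary_of_nodup hnd, hrw⟩
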